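/- The number of Dyck paths of length 2k with exactly i peaks equals the Narayana number N(k,i) = (1/k)·C(k,i)·C(k,i−1). -/

import Mathlib

/-- A list of booleans (`true` = up-step (1,1), `false` = down-step (1,−1)) is a
Dyck word if it has equally many up- and down-steps and no prefix has more
down-steps than up-steps. -/
def IsDyckWord (l : List Bool) : Prop :=
  l.count true = l.count false ∧
    ∀ p, p ≤ l.length → (l.take p).count false ≤ (l.take p).count true

instance : DecidablePred IsDyckWord := fun l => by
  unfold IsDyckWord; infer_instance

/-- The number of peaks (an up-step immediately followed by a down-step) of a path. -/
def peaks (l : List Bool) : ℕ := (l.zip l.tail).count (true, false)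

/-- A path starting at height `h` stays non-negative and ends at height `0`. -/
def DescendsFrom : ℕ → List Bool → Prop
  | h, [] => h = 0
  | h, true :: l => DescendsFrom (h + 1) l
  | 0, false :: _ => False
  | h + 1, false :: l => DescendsFrom h l

theorem descendsFrom_iff (l : List Bool) (h : ℕ) :
    DescendsFrom h l ↔ h + l.count true = l.count false ∧
      ∀ p, p ≤ l.length → (l.take p).count false ≤ h + (l.take p).count true := by
  induction l generalizing h with
  | nil => simp [DescendsFrom]
  | cons b l ih =>
    have split_prefix (P : ℕ → Prop) : (∀ p, p ≤ l.length + 1 → P p) ↔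
        P 0 ∧ ∀ p, p ≤ l.length → P (p + 1) := by
      refine ⟨fun H => ⟨H 0 (by omega), fun p hp => H _ (by omega)⟩, fun H p hp => ?_⟩
      cases p with
      | zero => exact H.1
      | succ p => exact H.2 p (by omega)
    rw [List.length_cons, split_prefix]
    cases b with
    | true =>
      rw [DescendsFrom, ih]
      simp [add_assoc, add_comm 1]
    | false =>
      cases h with
      | zero =>
        simp only [DescendsFrom, false_iff, not_and]
        intro _ _ H
        simpa using H 0
      | succ h =>
        rw [DescendsFrom, ih]
        simp [add_right_comm h 1]

theorem isDyckWord_iff_descendsFrom_zero (l : List Bool) : IsDyckWord l ↔ DescendsFrom 0 l := by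
  simp [IsDyckWord, descendsFrom_iff]

theorem DescendsFrom.le_length {h : ℕ} {l : List Bool} (H : DescendsFrom h l) : h ≤ l.length := by
  have := ((descendsFrom_iff l h).1 H).1
  have := l.count_le_length (a := false)
  omega

@[simp] theorem peaks_nil : peaks [] = 0 := rfl

@[simp] theorem peaks_false_cons (l : List Bool) : peaks (false :: l) = peaks l := by
  cases l <;> simp [peaks]

@[simp] theorem peaks_true_true_cons (l : List Bool) :
    peaks (true :: true :: l) = peaks (true :: l) := by
  simp [peaks]

@[simp] theorem peaks_true_false_cons (l : List Bool) :
    peaks (true :: false :: l) = peaks l + 1 := by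
  rw [← peaks_false_cons l]
  simp [peaks]

open Classical in
/-- The number of Boolean words of length `n` satisfying `P`. -/
noncomputable def wordCount (n : ℕ) (P : List Bool → Prop) : ℕ :=
  (Finset.univ.filter fun f : Fin n → Bool => P (List.ofFn f)).card

theorem wordCount_eq_zero {n : ℕ} {P : List Bool → Prop}
    (H : ∀ l, l.length = n → ¬ P l) : wordCount n P = 0 := by
  simpa [wordCount, Finset.filter_eq_empty_iff] using
    fun f : Fin n → Bool => H (List.ofFn f) (by simp)

theorem wordCount_zero (P : List Bool → Prop) [Decidable (P [])] : wordCount 0 P = if P [] then 1 else 0 := by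
  by_cases h : P [] <;> simp [wordCount, h]

open Classical in
theorem wordCount_succ (n : ℕ) (P : List Bool → Prop) :
    wordCount (n + 1) P =
      wordCount n (fun l => P (true :: l)) + wordCount n (fun l => P (false :: l)) := by
  simp only [wordCount, Finset.card_filter]
  rw [← (Fin.consEquiv fun _ : Fin (n + 1) => Bool).sum_comp, Fintype.sum_prod_type]
  simp [Fin.consEquiv, List.ofFn_succ]

/-- The number of descending paths of length `n` from height `h` with `i` peaks. -/
noncomputable def descentCount (n h i : ℕ) : ℕ :=
  wordCount n fun l => DescendsFrom h l ∧ peaks l = i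

/-- The number of descending paths of length `n` from height `h` which have `i` peaks when
preceded by an up-step. -/
noncomputable def descentCountAfterUp (n h i : ℕ) : ℕ :=
  wordCount n fun l => DescendsFrom h l ∧ peaks (true :: l) = i

theorem descentCountAfterUp_eq_zero {n h : ℕ} (i : ℕ) (H : n < h) :
    descentCountAfterUp n h i = 0 :=
  wordCount_eq_zero fun l hl hP => by have := hP.1.le_length; omega

theorem descentCount_succ_zero (n i : ℕ) :
    descentCount (n + 1) 0 i = descentCountAfterUp n 1 i := by
  simp [descentCount, descentCountAfterUp, wordCount_succ, DescendsFrom,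
    wordCount_eq_zero (P := fun _ => False)]

theorem descentCount_succ_succ (n h i : ℕ) :
    descentCount (n + 1) (h + 1) i =
      descentCountAfterUp n (h + 2) i + descentCount n h i := by
  simp [descentCount, descentCountAfterUp, wordCount_succ, DescendsFrom]

theorem descentCountAfterUp_succ_zero (n h : ℕ) :
    descentCountAfterUp (n + 1) (h + 1) 0 = descentCountAfterUp n (h + 2) 0 := by
  simp [descentCountAfterUp, wordCount_succ, DescendsFrom,
    wordCount_eq_zero (P := fun _ => False)]

theorem descentCountAfterUp_succ_succ (n h i : ℕ) :
    descentCountAfterUp (n + 1) (h + 1) (i + 1) =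
      descentCountAfterUp n (h + 2) (i + 1) + descentCount n h i := by
  simp [descentCount, descentCountAfterUp, wordCount_succ, DescendsFrom]

theorem descentCountAfterUp_zero_right (n h : ℕ) : descentCountAfterUp n (h + 1) 0 = 0 := by
  induction n generalizing h with
  | zero => exact descentCountAfterUp_eq_zero _ (by omega)
  | succ n ih => rw [descentCountAfterUp_succ_zero, ih]

theorem descentCount_self (h i : ℕ) : descentCount h h i = if i = 0 then 1 else 0 := by
  induction h with
  | zero =>
    classical
    rw [descentCount, wordCount_zero]
    simp [DescendsFrom, eq_comm]
  | succ h ih => rw [descentCount_succ_succ, descentCountAfterUp_eq_zero _ (by omega), ih, zero_add]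

/-- Closed forms for both counts, with `u` up-steps. -/
theorem descentCount_closed_forms (n : ℕ) :
    (∀ u h i, n = 2 * (u + 1) + h → (descentCount n h i : ℤ) =
      (u + 1).choose i * (u + 1 + h).choose i - (u + h + 2).choose i * u.choose i) ∧
    (∀ u h i, n = 2 * u + h + 1 → (descentCountAfterUp n (h + 1) (i + 1) : ℤ) =
      (u + 1).choose (i + 1) * (u + h).choose i -
        u.choose (i + 1) * (u + h + 1).choose i) := by
  induction n with
  | zero => exact ⟨fun u h i H => by omega, fun u h i H => by omega⟩
  | succ n ih =>
    obtain ⟨ihN, ihM⟩ := ih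
    constructor
    · intro u h i H
      cases h with
      | zero =>
        rw [descentCount_succ_zero]
        cases i with
        | zero => simp [descentCountAfterUp_zero_right]
        | succ i =>
          rw [ihM u 0 i (by omega)]
          simp only [add_zero, Nat.choose_succ_succ' (u + 1) i, Nat.choose_succ_succ' u i]
          push_cast
          ring
      | succ h =>
        rw [descentCount_succ_succ]
        cases i with
        | zero =>
          rw [descentCountAfterUp_zero_right, Nat.cast_add, ihN u h 0 (by omega)]
          simp
        | succ i =>
          rw [Nat.cast_add, ihM u (h + 1) i (by omega), ihN u h (i + 1) (by omega)]
          have e1 : u + 1 + (h + 1) = u + 1 + h + 1 := by ring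
          have e2 : u + (h + 1) + 2 = u + h + 2 + 1 := by ring
          have e3 : u + (h + 1) + 1 = u + h + 2 := by ring
          have e4 : u + (h + 1) = u + 1 + h := by ring
          rw [e1, e2, e3, e4, Nat.choose_succ_succ' (u + 1 + h) i,
            Nat.choose_succ_succ' (u + h + 2) i]
          push_cast
          ring
    · intro u h i H
      rw [descentCountAfterUp_succ_succ, Nat.cast_add]
      cases u with
      | zero =>
        obtain rfl : n = h := by omega
        rw [descentCountAfterUp_eq_zero _ (by omega), descentCount_self]
        cases i <;> simp [Nat.choose_eq_zero_of_lt]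
      | succ u =>
        rw [ihM u (h + 1) i (by omega), ihN u h i (by omega)]
        have e1 : u + (h + 1) = u + 1 + h := by ring
        have e2 : u + 1 + h + 1 = u + h + 2 := by ring
        rw [e1, e2, Nat.choose_succ_succ' (u + 1) i, Nat.choose_succ_succ' u i]
        push_cast
        ring

/-- The determinantal form of the Narayana numbers agrees with the product form. -/
theorem choose_sq_sub_eq_narayana {m j : ℕ} (hj : j ≤ m) :
    ((m + 1).choose (j + 1) : ℚ) * (m + 1).choose (j + 1) -
        (m + 2).choose (j + 1) * m.choose (j + 1) =
      1 / ((m + 1 : ℕ) : ℚ) * (m + 1).choose (j + 1) * (m + 1).choose j := by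
  obtain ⟨t, rfl⟩ := Nat.exists_eq_add_of_le hj
  have h₁ : ((j + t).choose (j + 1) : ℚ) * (j + t + 1) = (j + t + 1).choose (j + 1) * t := by
    have := Nat.choose_mul_succ_eq (j + t) (j + 1)
    rw [show j + t + 1 - (j + 1) = t by omega] at this
    exact_mod_cast this
  have h₂ : ((j + t + 1).choose (j + 1) : ℚ) * (j + t + 2) =
      (j + t + 2).choose (j + 1) * (t + 1) := by
    have := Nat.choose_mul_succ_eq (j + t + 1) (j + 1)
    rw [show j + t + 1 + 1 - (j + 1) = t + 1 by omega] at this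
    exact_mod_cast this
  have h₃ : ((j + t + 1).choose (j + 1) : ℚ) * (j + 1) = (j + t + 1).choose j * (t + 1) := by
    have := Nat.choose_succ_right_eq (j + t + 1) j
    rw [show j + t + 1 - j = t + 1 by omega] at this
    exact_mod_cast this
  have p₁ : (j + t + 1 : ℚ) ≠ 0 := by positivity
  have p₂ : (t + 1 : ℚ) ≠ 0 := by positivity
  rw [← eq_div_iff p₁] at h₁
  rw [← div_eq_iff p₂] at h₂ h₃
  rw [h₁, ← h₂, ← h₃]
  push_cast
  field_simp
  ring

/-- The number of Dyck paths of length 2k with exactly i peaks equals the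
Narayana number N(k,i) = (1/k)·C(k,i)·C(k,i−1). -/
theorem dyck_paths_narayana (k i : ℕ) (h1 : 1 ≤ i) (h2 : i ≤ k) :
    ((Finset.univ.filter (fun f : Fin (2 * k) → Bool =>
        IsDyckWord (List.ofFn f) ∧ peaks (List.ofFn f) = i)).card : ℚ)
      = (1 / (k : ℚ)) * (k.choose i) * (k.choose (i - 1)) := by
  obtain ⟨m, rfl⟩ : ∃ m, k = m + 1 := ⟨k - 1, by omega⟩
  obtain ⟨j, rfl⟩ : ∃ j, i = j + 1 := ⟨i - 1, by omega⟩
  have hcount : (Finset.univ.filter (fun f : Fin (2 * (m + 1)) → Bool =>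
      IsDyckWord (List.ofFn f) ∧ peaks (List.ofFn f) = j + 1)).card =
        descentCount (2 * (m + 1)) 0 (j + 1) := by
    simp only [descentCount, wordCount, ← isDyckWord_iff_descendsFrom_zero]
  have hclosed := (descentCount_closed_forms (2 * (m + 1))).1 m 0 (j + 1) rfl
  rw [hcount, Nat.add_sub_cancel, ← choose_sq_sub_eq_narayana (by omega)]
  exact_mod_cast hclosed
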